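/- Let q > 1, let C ⊆ (Z_q)^n be a finite code of strength 1, and let 𝐯 ∈ (Z_q)^n. Then Σ_{𝐮 ∈ 𝐯 + C} wt(𝐮) = n·φ(q)·|C|, where wt is the scaled homogeneous weight and the sum is over all translates 𝐯 + 𝐜 with 𝐜 ∈ C (counted with multiplicity). -/

import Mathlib

/-- `ζ_q^x = exp(2πi·x/q)` for `x ∈ ℤ/q`. -/
noncomputable def zetaPow (q : ℕ) (x : ZMod q) : ℂ :=
  Complex.exp (2 * Real.pi * Complex.I * x.val / q)

/-- The scaled homogeneous weight on `ℤ/q` (normalization `λ = φ(q)`), a real number: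
`wt(x) = φ(q) − ∑_{a ∈ (ℤ/q)ˣ} ζ_q^{a·x}` (the sum is real, so we take its real part). -/
noncomputable def wtHom (q : ℕ) [NeZero q] (x : ZMod q) : ℝ :=
  (Nat.totient q : ℝ) - (∑ a : (ZMod q)ˣ, zetaPow q ((a : ZMod q) * x)).re

theorem zetaPow_eq_stdAddChar (q : ℕ) [NeZero q] (x : ZMod q) :
    zetaPow q x = ZMod.stdAddChar x := by
  rw [ZMod.stdAddChar_apply, ZMod.toCircle_apply, zetaPow]

theorem sum_zetaPow_eq_zero (q : ℕ) (hq : 1 < q) [NeZero q] :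
    ∑ x : ZMod q, zetaPow q x = 0 := by
  have : Fact (1 < q) := ⟨hq⟩
  simp_rw [zetaPow_eq_stdAddChar]
  exact AddChar.sum_eq_zero_of_ne_one fun h =>
    one_ne_zero (ZMod.injective_stdAddChar (a₁ := (1 : ZMod q)) (a₂ := 0) (by simp [h]))

theorem sum_wtHom (q : ℕ) (hq : 1 < q) [NeZero q] :
    ∑ x : ZMod q, wtHom q x = (q : ℝ) * Nat.totient q := by
  have h : ∑ x : ZMod q, ∑ a : (ZMod q)ˣ, zetaPow q ((a : ZMod q) * x) = 0 := by
    rw [Finset.sum_comm]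
    refine Finset.sum_eq_zero fun a _ => ?_
    rw [← sum_zetaPow_eq_zero q hq]
    exact Equiv.sum_comp a.mulLeft (zetaPow q)
  simp only [wtHom, Finset.sum_sub_distrib, ← Complex.re_sum, h]
  simp [ZMod.card]

/-- Summing a function along an equidistributed map amounts to averaging it. -/
theorem card_mul_sum_comp_of_equidistributed {ι α : Type*} [Fintype α] [DecidableEq α]
    (C : Finset ι) (g : ι → α) (m : ℕ)
    (h : ∀ a, m * (C.filter (fun c => g c = a)).card = C.card) (f : α → ℝ) :
    (m : ℝ) * ∑ c ∈ C, f (g c) = C.card * ∑ a, f a := by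
  rw [← Finset.sum_fiberwise C g, Finset.mul_sum, Finset.mul_sum]
  refine Finset.sum_congr rfl fun a _ => ?_
  rw [Finset.sum_congr rfl fun c hc => congrArg f (Finset.mem_filter.mp hc).2,
    Finset.sum_const, nsmul_eq_mul, ← h a]
  push_cast
  ring

/-- if `q > 1` and `C ⊆ (ℤ/q)^n` is a (finite) code of strength 1 (each
coordinate takes each value `α ∈ ℤ/q` exactly `|C|/q` times), then for every
`𝐯 ∈ (ℤ/q)^n`, `∑_{𝐮 ∈ 𝐯 + C} wt(𝐮) = n·φ(q)·|C|`. -/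
theorem sum_wtHom_translate_strength_one (q n : ℕ) (hq : 1 < q) [NeZero q]
    (C : Finset (Fin n → ZMod q))
    (hstr : ∀ i : Fin n, ∀ α : ZMod q,
      q * (C.filter (fun c => c i = α)).card = C.card)
    (v : Fin n → ZMod q) :
    ∑ c ∈ C, ∑ i, wtHom q ((v + c) i) = (n : ℝ) * (Nat.totient q : ℝ) * C.card := by
  have hq0 : (q : ℝ) ≠ 0 := Nat.cast_ne_zero.mpr (NeZero.ne q)
  have hi : ∀ i, ∑ c ∈ C, wtHom q ((v + c) i) = (Nat.totient q : ℝ) * C.card := fun i => by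
    apply mul_left_cancel₀ hq0
    have h := card_mul_sum_comp_of_equidistributed C (fun c => c i) q (hstr i)
      (fun a => wtHom q (v i + a))
    rw [show ∑ a, wtHom q (v i + a) = ∑ a, wtHom q a from
      Equiv.sum_comp (Equiv.addLeft (v i)) (wtHom q), sum_wtHom q hq] at h
    simp only [Pi.add_apply]
    rw [h]
    ring
  rw [Finset.sum_comm, Finset.sum_congr rfl fun i _ => hi i]
  simp [mul_assoc]
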